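/- Let A be an n×n symmetric nonnegative matrix with strictly positive main diagonal. Then there exists a positive definite diagonal matrix D such that B = D^{−1/2} A D^{−1/2} is symmetric bi-stochastic, i.e., B𝟏 = 𝟏 (and by symmetry Bᵀ𝟏 = 𝟏); moreover D is unique. -/

import Mathlib

open Matrix Finset

noncomputable section

/-- The all-ones vector. -/
def onesVec (n : ℕ) : Fin n → ℝ := fun _ => 1

/-- Quadratic form of a matrix. -/
def quadForm {n : ℕ} (L : Matrix (Fin n) (Fin n) ℝ) (x : Fin n → ℝ) : ℝ :=
  x ⬝ᵥ (L *ᵥ x)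

/-- Mean-zero unit vectors. -/
def meanZeroUnit (n : ℕ) : Set (Fin n → ℝ) :=
  {x | onesVec n ⬝ᵥ x = 0 ∧ x ⬝ᵥ x = 1}

/-- The second smallest eigenvalue: the infimum of the Rayleigh quotient over
mean-zero unit vectors (for a PSD matrix with kernel spanned by `onesVec`). -/
def lam1 {n : ℕ} (L : Matrix (Fin n) (Fin n) ℝ) : ℝ :=
  sInf (quadForm L '' meanZeroUnit n)

/-- The probability simplex. -/
def simplex (m : ℕ) : Set (Fin m → ℝ) := {t | (∀ k, 0 ≤ t k) ∧ ∑ k, t k = 1}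

/-- The normalized combination `L_t = ∑ t_k L_k / λ₁(L_k)`. -/
def Lt {n m : ℕ} (L : Fin m → Matrix (Fin n) (Fin n) ℝ) (t : Fin m → ℝ) :
    Matrix (Fin n) (Fin n) ℝ := ∑ k, (t k / lam1 (L k)) • L k

/-- The kernel of `L` is spanned by the all-ones vector. -/
def kernelOnes {n : ℕ} (L : Matrix (Fin n) (Fin n) ℝ) : Prop :=
  ∀ x : Fin n → ℝ, L *ᵥ x = 0 ↔ ∃ c : ℝ, x = fun _ => c

/-- The second smallest eigenvalue of `M` is simple. -/
def simpleLam1 {n : ℕ} (M : Matrix (Fin n) (Fin n) ℝ) : Prop :=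
  ∀ x ∈ meanZeroUnit n, ∀ y ∈ meanZeroUnit n,
    M *ᵥ x = lam1 M • x → M *ᵥ y = lam1 M • y → y = x ∨ y = -x

/-- The worst-case normalized smoothness score over the `m` graphs. -/
def maxScore {n m : ℕ} [Nonempty (Fin m)] (L : Fin m → Matrix (Fin n) (Fin n) ℝ)
    (x : Fin n → ℝ) : ℝ :=
  Finset.univ.sup' Finset.univ_nonempty (fun k => quadForm (L k) x / lam1 (L k))

end

lemma sk_term_nonneg {p q : ℝ} (hp : 0 < p) (hq : 0 < q) :
    0 ≤ (1 / p - 1 / q) * (Real.log q - Real.log p) := by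
  rcases le_total p q with h | h
  · exact mul_nonneg (sub_nonneg.2 (one_div_le_one_div_of_le hp h))
      (sub_nonneg.2 (Real.log_le_log hp h))
  · exact mul_nonneg_of_nonpos_of_nonpos (sub_nonpos.2 (one_div_le_one_div_of_le hq h))
      (sub_nonpos.2 (Real.log_le_log hq h))

lemma sk_term_eq {p q : ℝ} (hp : 0 < p) (hq : 0 < q)
    (h : (1 / p - 1 / q) * (Real.log q - Real.log p) = 0) : p = q := by
  rcases mul_eq_zero.1 h with h | h
  · have h2 : 1 / p = 1 / q := sub_eq_zero.1 h
    rw [one_div, one_div] at h2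
    exact inv_injective h2
  · exact (Real.log_injOn_pos hq hp (sub_eq_zero.1 h)).symm

/-- Uniqueness in terms of square roots. -/
lemma sk_unique {n : ℕ} (A : Matrix (Fin n) (Fin n) ℝ)
    (hsymm : A.IsSymm) (hnonneg : ∀ i j, 0 ≤ A i j) (hdiag : ∀ i, 0 < A i i)
    (s t : Fin n → ℝ) (hs : ∀ i, 0 < s i) (ht : ∀ i, 0 < t i)
    (h1 : ∀ i, ∑ j, A i j / (s i * s j) = 1) (h2 : ∀ i, ∑ j, A i j / (t i * t j) = 1) :
    s = t := by
  have hA : ∀ i j, A j i = A i j := fun i j => hsymm.apply i j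
  let w : Fin n → ℝ := fun i => Real.log (t i) - Real.log (s i)
  let C : Fin n → Fin n → ℝ := fun i j => A i j / (s i * s j) - A i j / (t i * t j)
  have hC : ∀ i, ∑ j, C i j = 0 := fun i => by
    simp only [C, Finset.sum_sub_distrib, h1, h2, sub_self]
  have hCs : ∀ i j, C j i = C i j := fun i j => by
    simp only [C, hA i j, mul_comm]
  have z1 : ∑ i, ∑ j, C i j * w i = 0 := by
    simp only [← Finset.sum_mul, hC, zero_mul, Finset.sum_const_zero]
  have z2 : ∑ i, ∑ j, C i j * w j = 0 := by
    rw [Finset.sum_comm]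
    simp only [← Finset.sum_mul, ← hCs, hC, zero_mul, Finset.sum_const_zero]
  have e : ∀ i j, C i j * w i + C i j * w j =
      A i j * ((1 / (s i * s j) - 1 / (t i * t j)) *
        (Real.log (t i * t j) - Real.log (s i * s j))) := fun i j => by
    rw [Real.log_mul (hs i).ne' (hs j).ne', Real.log_mul (ht i).ne' (ht j).ne']
    simp only [C, w]; ring
  have z : ∑ i, ∑ j, (C i j * w i + C i j * w j) = 0 := by
    simp only [Finset.sum_add_distrib, z1, z2, add_zero]
  have nn : ∀ i j, 0 ≤ C i j * w i + C i j * w j := fun i j => by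
    rw [e]
    exact mul_nonneg (hnonneg i j)
      (sk_term_nonneg (mul_pos (hs i) (hs j)) (mul_pos (ht i) (ht j)))
  funext i
  have a1 := (Finset.sum_eq_zero_iff_of_nonneg
    (fun i _ => Finset.sum_nonneg (fun j _ => nn i j))).1 z i (Finset.mem_univ i)
  have a2 := (Finset.sum_eq_zero_iff_of_nonneg (fun j _ => nn i j)).1 a1 i (Finset.mem_univ i)
  rw [e] at a2
  have a3 := (mul_eq_zero.1 a2).resolve_left (hdiag i).ne'
  have a4 := sk_term_eq (mul_pos (hs i) (hs i)) (mul_pos (ht i) (ht i)) a3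
  exact (mul_self_inj (hs i).le (ht i).le).1 a4

lemma sk_bound {a : ℝ} (ha : 0 < a) (t : ℝ) :
    |t| - 1 / a ≤ a / 2 * Real.exp (t + t) - t := by
  have hi : 0 < 1 / a := by positivity
  rcases le_total 0 t with h | h
  · rw [abs_of_nonneg h]
    have h1 := Real.quadratic_le_exp_of_nonneg (x := t + t) (by linarith)
    have h2 : a / 2 * (2 * t ^ 2) ≤ a / 2 * Real.exp (t + t) :=
      mul_le_mul_of_nonneg_left (by nlinarith) (by positivity)
    have h3 : 0 ≤ a * (t - 1 / a) ^ 2 := by positivity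
    have h4 : a * (t - 1 / a) ^ 2 = a * t ^ 2 - 2 * t + 1 / a := by
      field_simp
      ring
    linarith
  · rw [abs_of_nonpos h]
    have : 0 < a / 2 * Real.exp (t + t) := by positivity
    linarith

lemma sk_exists {n : ℕ} (A : Matrix (Fin n) (Fin n) ℝ)
    (hsymm : A.IsSymm) (hnonneg : ∀ i j, 0 ≤ A i j) (hdiag : ∀ i, 0 < A i i) :
    ∃ y : Fin n → ℝ, ∀ i, ∑ j, A i j * Real.exp (y i + y j) = 1 := by
  have hA : ∀ i j, A j i = A i j := fun i j => hsymm.apply i j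
  let f : (Fin n → ℝ) → ℝ := fun y =>
    ∑ i, ((∑ j, A i j / 2 * Real.exp (y i + y j)) - y i)
  have hf : Continuous f := by fun_prop
  have hb : ∀ y, ‖y‖ + (-∑ i, 1 / A i i) ≤ f y := fun y => by
    have h1 : ‖y‖ ≤ ∑ i, |y i| := by
      refine (pi_norm_le_iff_of_nonneg (Finset.sum_nonneg fun i _ => abs_nonneg _)).2 fun i => ?_
      exact Finset.single_le_sum (f := fun i => |y i|) (fun i _ => abs_nonneg _)
        (Finset.mem_univ i)
    have h2 : ∑ i, (|y i| - 1 / A i i) ≤ f y := by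
      refine Finset.sum_le_sum fun i _ => (sk_bound (hdiag i) (y i)).trans ?_
      refine sub_le_sub_right ?_ _
      exact Finset.single_le_sum (f := fun j => A i j / 2 * Real.exp (y i + y j))
        (fun j _ => mul_nonneg (div_nonneg (hnonneg i j) (by norm_num)) (Real.exp_pos _).le)
        (Finset.mem_univ i)
    rw [Finset.sum_sub_distrib] at h2
    linarith
  have hlim : Filter.Tendsto f (Filter.cocompact _) Filter.atTop :=
    Filter.tendsto_atTop_mono hb
      (Filter.tendsto_atTop_add_const_right _ _ (tendsto_norm_cocompact_atTop))
  obtain ⟨y, hy⟩ := hf.exists_forall_le hlim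
  refine ⟨y, fun k => ?_⟩
  let v : Fin n → ℝ := Pi.single k 1
  have hd : HasDerivAt (fun t : ℝ => f (fun i => y i + t * v i))
      (∑ i, ((∑ j, A i j / 2 * (Real.exp ((y i + 0 * v i) + (y j + 0 * v j)) *
        (v i + v j))) - v i)) 0 := by
    have hl : ∀ i, HasDerivAt (fun t : ℝ => y i + t * v i) (v i) 0 := fun i => by
      simpa using ((hasDerivAt_id (0 : ℝ)).mul_const (v i)).const_add (y i)
    refine HasDerivAt.fun_sum fun i _ => HasDerivAt.fun_sub ?_ (hl i)
    refine HasDerivAt.fun_sum fun j _ => HasDerivAt.const_mul _ ?_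
    exact ((hl i).fun_add (hl j)).exp
  have hm : IsLocalMin (fun t : ℝ => f (fun i => y i + t * v i)) 0 := by
    refine Filter.Eventually.of_forall fun t => ?_
    simpa using hy (fun i => y i + t * v i)
  have h0 := hm.hasDerivAt_eq_zero hd
  simp only [zero_mul, add_zero, mul_add, Finset.sum_sub_distrib, Finset.sum_add_distrib] at h0
  have hv : ∑ i, v i = 1 := by simp [v]
  have p1 : ∑ i, ∑ j, A i j / 2 * (Real.exp (y i + y j) * v i) =
      ∑ j, A k j / 2 * Real.exp (y k + y j) := by
    rw [Finset.sum_eq_single k]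
    · simp [v]
    · intro i _ hi; simp [v, hi]
    · simp
  have p2 : ∑ i, ∑ j, A i j / 2 * (Real.exp (y i + y j) * v j) =
      ∑ j, A k j / 2 * Real.exp (y k + y j) := by
    rw [Finset.sum_comm, ← p1]
    refine Finset.sum_congr rfl fun i _ => Finset.sum_congr rfl fun j _ => ?_
    rw [hA i j, add_comm (y j)]
  rw [p1, p2, hv, ← Finset.sum_add_distrib] at h0
  rw [← sub_eq_zero, ← h0]
  congr 1
  refine Finset.sum_congr rfl fun j _ => ?_
  ring

/-- symmetric Sinkhorn–Knopp: existence and uniqueness of the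
positive diagonal scaling making `D^{-1/2} A D^{-1/2}` bi-stochastic. -/
theorem sinkhorn_knopp {n : ℕ} (A : Matrix (Fin n) (Fin n) ℝ)
    (hsymm : A.IsSymm) (hnonneg : ∀ i j, 0 ≤ A i j) (hdiag : ∀ i, 0 < A i i) :
    ∃! d : Fin n → ℝ, (∀ i, 0 < d i) ∧
      (Matrix.of fun i j => A i j / (Real.sqrt (d i) * Real.sqrt (d j))) *ᵥ
        onesVec n = onesVec n := by
  have key : ∀ d : Fin n → ℝ,
      ((Matrix.of fun i j => A i j / (Real.sqrt (d i) * Real.sqrt (d j))) *ᵥ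
        onesVec n = onesVec n) ↔
      ∀ i, ∑ j, A i j / (Real.sqrt (d i) * Real.sqrt (d j)) = 1 := fun d => by
    simp [funext_iff, Matrix.mulVec, dotProduct, onesVec]
  simp only [key]
  obtain ⟨y, hy⟩ := sk_exists A hsymm hnonneg hdiag
  have hsq : ∀ i, Real.sqrt (Real.exp (-y i) * Real.exp (-y i)) = Real.exp (-y i) :=
    fun i => Real.sqrt_mul_self (Real.exp_pos _).le
  have hy' : ∀ i, ∑ j, A i j / (Real.exp (-y i) * Real.exp (-y j)) = 1 := fun i => by
    rw [← hy i]
    refine Finset.sum_congr rfl fun j _ => ?_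
    rw [← Real.exp_add, div_eq_mul_inv, ← Real.exp_neg]
    congr 2
    ring
  refine ⟨fun i => Real.exp (-y i) * Real.exp (-y i), ⟨fun i => by positivity, ?_⟩, ?_⟩
  · simpa only [hsq] using hy'
  · rintro d ⟨hd, h⟩
    have hu := sk_unique A hsymm hnonneg hdiag (fun i => Real.sqrt (d i))
      (fun i => Real.exp (-y i)) (fun i => Real.sqrt_pos.2 (hd i))
      (fun i => Real.exp_pos _) h hy'
    funext i
    have hi : Real.sqrt (d i) = Real.exp (-y i) := congrFun hu i
    rw [← hi, Real.mul_self_sqrt (hd i).le]
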